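/- Let F : (𝕂ⁿ × 𝕂, 0) → (𝕂, 0) be an analytic deformation satisfying condition (*): for every x₀ ∈ Sing F₀ ∩ {∂F/∂t(·, 0) = 0}, there exists c > 0 with |∂F/∂t(x,t)| ≤ c·‖(∂F/∂x₁, …, ∂F/∂xₙ)(x,t)‖ for (x,t) near (x₀, 0). Then, as germs at the origin, Sing F = Sing F̃, where F̃(x,t) = (F(x,t), t). Consequently the discriminant F̃(Sing F̃) is contained in {0} × 𝕂. -/

import Mathlib

open Filter Metric Set Topology

universe u
set_option linter.unusedSectionVars false

section FC
variable {𝕜 : Type*} [RCLike 𝕜] {E : Type*} [NormedAddCommGroup E] [NormedSpace 𝕜 E]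
  {ι : Type*} [Fintype ι] {A : Type*} [NormedRing A] [NormedAlgebra 𝕜 A] [NormOneClass A]
  

/-- Extension of scalars of a formal multilinear series along a basis. -/
noncomputable def fcSeries (b : Module.Basis ι 𝕜 E) (A : Type*) [NormedRing A] [NormedAlgebra 𝕜 A]
    (p : FormalMultilinearSeries 𝕜 E 𝕜) :
    FormalMultilinearSeries 𝕜 (ι → A) A := fun k =>
  ∑ i : Fin k → ι, p k (fun j => b (i j)) •
    (ContinuousMultilinearMap.mkPiAlgebraFin 𝕜 k A).compContinuousLinearMap
      (fun j => ContinuousLinearMap.proj (R := 𝕜) (φ := fun _ : ι => A) (i j))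

lemma fcSeries_apply (b : Module.Basis ι 𝕜 E) (p : FormalMultilinearSeries 𝕜 E 𝕜) (k : ℕ)
    (y : ι → A) : fcSeries b A p k (fun _ => y) =
      ∑ i : Fin k → ι, p k (fun j => b (i j)) • (List.ofFn fun j => y (i j)).prod := by
  simp [fcSeries]

lemma fcSeries_norm (b : Module.Basis ι 𝕜 E) (p : FormalMultilinearSeries 𝕜 E 𝕜) (k : ℕ) :
    ‖fcSeries b A p k‖ ≤ ‖p k‖ * ((Fintype.card ι : ℝ) * ∑ i, ‖b i‖) ^ k := by
  have hB : ∀ i, ‖b i‖ ≤ ∑ i, ‖b i‖ := fun i =>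
    Finset.single_le_sum (f := fun i => ‖b i‖) (fun i _ => norm_nonneg (b i)) (Finset.mem_univ i)
  refine ContinuousMultilinearMap.opNorm_le_bound (by positivity) fun m => ?_
  have hm : fcSeries b A p k m = ∑ i : Fin k → ι, p k (fun j => b (i j)) •
      ContinuousMultilinearMap.mkPiAlgebraFin 𝕜 k A (fun j => m j (i j)) := by
    simp [fcSeries]
  rw [hm]
  calc ‖∑ i : Fin k → ι, p k (fun j => b (i j)) •
      ContinuousMultilinearMap.mkPiAlgebraFin 𝕜 k A (fun j => m j (i j))‖
      ≤ ∑ i : Fin k → ι, (‖p k‖ * (∑ i, ‖b i‖) ^ k) * ∏ j, ‖m j‖ := by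
        refine norm_sum_le_of_le _ fun i _ => ?_
        rw [norm_smul]
        have h1 : ‖p k (fun j => b (i j))‖ ≤ ‖p k‖ * (∑ i, ‖b i‖) ^ k := by
          refine (ContinuousMultilinearMap.le_opNorm _ _).trans ?_
          gcongr
          calc ∏ j, ‖b (i j)‖ ≤ ∏ _j : Fin k, (∑ i, ‖b i‖) := by
                gcongr with j; exact hB _
            _ = _ := by simp
        have h2 : ‖ContinuousMultilinearMap.mkPiAlgebraFin 𝕜 k A (fun j => m j (i j))‖
            ≤ ∏ j, ‖m j‖ := by
          refine (ContinuousMultilinearMap.le_opNorm _ _).trans ?_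
          rw [ContinuousMultilinearMap.norm_mkPiAlgebraFin, one_mul]
          gcongr with j
          exact norm_le_pi_norm (m j) (i j)
        gcongr
    _ = _ := by
        simp [mul_pow]; ring

lemma fcSeries_radius (b : Module.Basis ι 𝕜 E) (p : FormalMultilinearSeries 𝕜 E 𝕜)
    (hp : 0 < p.radius) : 0 < (fcSeries b A p).radius := by
  obtain ⟨C, r, hC, hr, h⟩ := p.le_mul_pow_of_radius_pos hp
  set M : ℝ := (Fintype.card ι : ℝ) * ∑ i, ‖b i‖
  have hM : 0 ≤ M := by positivity
  have hpos : 0 < (r * M + 1)⁻¹ := by positivity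
  refine lt_of_lt_of_le ?_ ((fcSeries b A p).le_radius_of_bound C (r := (⟨(r * M + 1)⁻¹, hpos.le⟩ : NNReal)) ?_)
  · exact ENNReal.coe_pos.2 (show (0 : NNReal) < ⟨(r * M + 1)⁻¹, hpos.le⟩ from hpos)
  · intro k
    show ‖fcSeries b A p k‖ * ((r * M + 1)⁻¹) ^ k ≤ C
    calc _ ≤ (‖p k‖ * M ^ k) * ((r * M + 1)⁻¹) ^ k := by gcongr; exact fcSeries_norm b p k
      _ ≤ (C * r ^ k * M ^ k) * ((r * M + 1)⁻¹) ^ k := by gcongr; exact h k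
      _ = C * ((r * M) / (r * M + 1)) ^ k := by rw [div_eq_mul_inv]; simp only [mul_pow]; ring
      _ ≤ C * 1 ^ k := by
          gcongr
          rw [div_le_one (by positivity)]; linarith
      _ = C := by simp

lemma fc_prod (b : Module.Basis ι 𝕜 E) (y : ι → A) (c : E) (Λ : A →L[𝕜] 𝕜)
    (hΛ : ∀ i a, Λ (y i * a) = b.repr c i * Λ a) :
    ∀ (k : ℕ) (i : Fin k → ι), Λ (List.ofFn fun j => y (i j)).prod
      = (∏ j, b.repr c (i j)) * Λ 1 := by
  intro k
  induction k with
  | zero => intro i; simp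
  | succ k ih =>
    intro i
    rw [List.ofFn_succ, List.prod_cons, hΛ, ih (fun j => i j.succ), Fin.prod_univ_succ]
    ring

lemma fc_term (b : Module.Basis ι 𝕜 E) (p : FormalMultilinearSeries 𝕜 E 𝕜)
    (y : ι → A) (c : E) (Λ : A →L[𝕜] 𝕜)
    (hΛ : ∀ i a, Λ (y i * a) = b.repr c i * Λ a) (k : ℕ) :
    Λ (fcSeries b A p k (fun _ => y)) = p k (fun _ => c) * Λ 1 := by
  have h1 : p k (fun _ => c) = ∑ i : Fin k → ι, (∏ j, b.repr c (i j)) * p k (fun j => b (i j)) := by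
    classical
    conv_lhs => rw [← b.sum_repr c]
    rw [ContinuousMultilinearMap.map_sum]
    refine Finset.sum_congr rfl fun i _ => ?_
    rw [ContinuousMultilinearMap.map_smul_univ, smul_eq_mul]
  rw [fcSeries_apply, map_sum, h1, Finset.sum_mul]
  refine Finset.sum_congr rfl fun i _ => ?_
  rw [map_smul, fc_prod b y c Λ hΛ, smul_eq_mul]
  ring

lemma fc_exists [CompleteSpace A] (b : Module.Basis ι 𝕜 E) (g : E → 𝕜) (hg : AnalyticAt 𝕜 g 0) :
    ∃ G : (ι → A) → A, ∃ r > (0 : ℝ), (∀ y, ‖y‖ < r → AnalyticAt 𝕜 G y) ∧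
      ∀ y c, ‖y‖ < r → ‖c‖ < r → ∀ Λ : A →L[𝕜] 𝕜,
        (∀ i a, Λ (y i * a) = b.repr c i * Λ a) → Λ (G y) = g c * Λ 1 := by
  obtain ⟨p, R, hp⟩ := hg
  have hrad := fcSeries_radius (A := A) b p (hp.r_pos.trans_le hp.r_le)
  have hq := (fcSeries b A p).hasFPowerSeriesOnBall hrad
  obtain ⟨r, hr0, hr⟩ := ENNReal.lt_iff_exists_nnreal_btwn.1 (lt_min hrad hp.r_pos)
  rw [lt_min_iff] at hr
  have hr0' : (0 : ℝ) < r := by exact_mod_cast hr0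
  have key : ∀ {X : Type _} [NormedAddCommGroup X] (x : X), ‖x‖ < r → ∀ ρ : ENNReal, (r : ENNReal) < ρ →
      x ∈ Metric.eball (0 : X) ρ := by
    intro X _ x hx ρ hρ
    rw [Metric.mem_eball, edist_zero_right]
    refine lt_trans ?_ hρ
    rw [enorm_eq_nnnorm]
    exact_mod_cast hx
  have key' : ∀ x : E, ‖x‖ < r → ∀ ρ : ENNReal, (r : ENNReal) < ρ →
      x ∈ Metric.eball (0 : E) ρ := by
    intro x hx ρ hρ
    rw [Metric.mem_eball, edist_zero_right]
    refine lt_trans ?_ hρ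
    rw [enorm_eq_nnnorm]
    exact_mod_cast hx
  refine ⟨(fcSeries b A p).sum, r, hr0', fun y hy => ?_, fun y c hy hc Λ hΛ => ?_⟩
  · exact hq.analyticAt_of_mem (key y hy _ hr.1)
  · have h1 := (hq.hasSum (key y hy _ hr.1)).mapL Λ
    have h2 := (hp.hasSum (key' c hc _ hr.2)).mul_right (Λ 1)
    simp only [zero_add] at h1 h2
    simp only [fc_term b p y c Λ hΛ] at h1
    exact h1.unique h2
end FC
section Shift
open scoped BoundedContinuousFunction

/-- A Banach space of one-variable power series, seen through its shift operators. -/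
structure ShiftData (𝕜 : Type*) [RCLike 𝕜] (V : Type*) [NormedAddCommGroup V]
    [NormedSpace 𝕜 V] where
  L : V →L[𝕜] V
  S : V →L[𝕜] V
  δ : V →L[𝕜] 𝕜
  e : V
  LS : ∀ v, L (S v) = v
  δS : ∀ v, δ (S v) = 0
  δe : δ e = 1
  Le : L e = 0
  dec : ∀ v, v = S (L v) + δ v • e
  normL : ‖L‖ ≤ 1
  sep : ∀ v, (∀ n : ℕ, δ ((L ^ n) v) = 0) → v = 0

noncomputable def bcfL (𝕜 : Type*) [RCLike 𝕜] : (ℕ →ᵇ 𝕜) →L[𝕜] (ℕ →ᵇ 𝕜) :=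
  LinearMap.mkContinuous
    { toFun := fun v => v.compContinuous ⟨Nat.succ, continuous_of_discreteTopology⟩
      map_add' := fun _ _ => rfl
      map_smul' := fun _ _ => rfl } 1
    (fun v => by
      rw [one_mul]
      refine (BoundedContinuousFunction.norm_le (norm_nonneg _)).2 fun n => ?_
      exact v.norm_coe_le_norm (n + 1))

noncomputable def bcfS (𝕜 : Type*) [RCLike 𝕜] : (ℕ →ᵇ 𝕜) →L[𝕜] (ℕ →ᵇ 𝕜) :=
  LinearMap.mkContinuous
    { toFun := fun v => BoundedContinuousFunction.ofNormedAddCommGroupDiscrete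
        (fun n => Nat.casesOn n 0 (fun m => v m)) ‖v‖ (fun n => by
          cases n with
          | zero => simp
          | succ m => exact v.norm_coe_le_norm m)
      map_add' := fun v w => by
        ext n
        cases n <;> simp
      map_smul' := fun c v => by
        ext n
        cases n <;> simp } 1
    (fun v => by
      rw [one_mul]
      refine (BoundedContinuousFunction.norm_le (norm_nonneg _)).2 fun n => ?_
      cases n with
      | zero => simp
      | succ m => exact v.norm_coe_le_norm m)

lemma bcfL_apply {𝕜 : Type*} [RCLike 𝕜] (v : ℕ →ᵇ 𝕜) (n : ℕ) : bcfL 𝕜 v n = v (n + 1) := rfl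
lemma bcfS_zero {𝕜 : Type*} [RCLike 𝕜] (v : ℕ →ᵇ 𝕜) : bcfS 𝕜 v 0 = 0 := rfl
lemma bcfS_succ {𝕜 : Type*} [RCLike 𝕜] (v : ℕ →ᵇ 𝕜) (n : ℕ) : bcfS 𝕜 v (n + 1) = v n := rfl

noncomputable def shiftBCF (𝕜 : Type*) [RCLike 𝕜] : ShiftData 𝕜 (ℕ →ᵇ 𝕜) where
  L := bcfL 𝕜
  S := bcfS 𝕜
  δ := BoundedContinuousFunction.evalCLM 𝕜 0
  e := BoundedContinuousFunction.ofNormedAddCommGroupDiscrete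
        (fun n => Nat.casesOn n 1 (fun _ => 0)) 1 (fun n => by cases n <;> simp)
  LS := fun v => by ext n; rfl
  δS := fun v => rfl
  δe := rfl
  Le := by ext n; rfl
  dec := fun v => by
    ext n
    cases n with
    | zero => simp [bcfS_zero]
    | succ m => simp [bcfS_succ, bcfL_apply]
  normL := LinearMap.mkContinuous_norm_le _ zero_le_one _
  sep := fun v hv => by
    have h : ∀ n (w : ℕ →ᵇ 𝕜) k, ((bcfL 𝕜) ^ n) w k = w (k + n) := by
      intro n
      induction n with
      | zero => intro w k; rfl
      | succ n ih =>
        intro w k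
        rw [pow_succ, mul_apply_eq_comp, ih, bcfL_apply]
        rfl
    ext n
    have := hv n
    rw [BoundedContinuousFunction.evalCLM_apply, h] at this
    simpa using this

namespace ShiftData
variable {𝕜 : Type*} [RCLike 𝕜] {V : Type*} [NormedAddCommGroup V] [NormedSpace 𝕜 V]
  [CompleteSpace V] (X : ShiftData 𝕜 V)

/-- evaluation of a power series at `s` -/
noncomputable def ev (s : 𝕜) : V →L[𝕜] 𝕜 := X.δ ∘L (Ring.inverse (1 - s • X.L))

lemma isUnit (s : 𝕜) (hs : ‖s‖ < 1) : IsUnit (1 - s • X.L) := by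
  apply isUnit_one_sub_of_norm_lt_one
  rw [norm_smul]
  calc ‖s‖ * ‖X.L‖ ≤ ‖s‖ * 1 := by gcongr; exact X.normL
    _ < 1 := by simpa using hs

lemma ev_rec (s : 𝕜) (hs : ‖s‖ < 1) (v : V) : X.ev s v = X.δ v + s * X.ev s (X.L v) := by
  have h1 : Ring.inverse (1 - s • X.L) * (1 - s • X.L) = 1 :=
    Ring.inverse_mul_cancel _ (X.isUnit s hs)
  have h2 := congrArg (fun T : V →L[𝕜] V => X.δ (T v)) h1
  simp only [mul_apply_eq_comp, sub_apply,
    one_apply_eq_self, smul_apply, map_sub, map_smul,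
    smul_eq_mul] at h2
  simp only [ev, ContinuousLinearMap.comp_apply]
  rw [← h2]; ring

lemma ev_S (s : 𝕜) (hs : ‖s‖ < 1) (v : V) : X.ev s (X.S v) = s * X.ev s v := by
  rw [X.ev_rec s hs, X.δS, X.LS, zero_add]

lemma ev_e (s : 𝕜) (hs : ‖s‖ < 1) : X.ev s X.e = 1 := by
  rw [X.ev_rec s hs, X.δe, X.Le, map_zero, mul_zero, add_zero]

lemma ev_analytic (s : 𝕜) (hs : ‖s‖ < 1) : AnalyticAt 𝕜 X.ev s := by
  obtain ⟨U, hU⟩ := X.isUnit s hs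
  have h1 : AnalyticAt 𝕜 (fun s : 𝕜 => (1 : V →L[𝕜] V) - s • X.L) s := by fun_prop
  have h2 : AnalyticAt 𝕜 (fun s : 𝕜 => Ring.inverse ((1 : V →L[𝕜] V) - s • X.L)) s := by
    refine AnalyticAt.fun_comp ?_ h1
    rw [← hU]
    exact analyticAt_inverse U
  exact (((ContinuousLinearMap.compL 𝕜 V V 𝕜) X.δ).analyticAt _).comp h2

lemma ev_sep (v : V) (hv : ∀ᶠ s in 𝓝 (0 : 𝕜), X.ev s v = 0) : v = 0 := by
  have hsmall : ∀ᶠ s in 𝓝 (0 : 𝕜), ‖s‖ < 1 := by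
    have := Metric.ball_mem_nhds (0 : 𝕜) one_pos
    filter_upwards [this] with s hs using by simpa using hs
  have step : ∀ w : V, (∀ᶠ s in 𝓝 (0 : 𝕜), X.ev s w = 0) →
      X.δ w = 0 ∧ ∀ᶠ s in 𝓝 (0 : 𝕜), X.ev s (X.L w) = 0 := by
    intro w hw
    have h0 : X.δ w = 0 := by
      have h1 := hw.self_of_nhds
      rw [X.ev_rec 0 (by simp)] at h1
      simpa using h1
    refine ⟨h0, ?_⟩
    have han : AnalyticAt 𝕜 (fun s => X.ev s (X.L w)) 0 :=
      (((ContinuousLinearMap.apply 𝕜 𝕜 (X.L w)).analyticAt _).comp (X.ev_analytic 0 (by simp)))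
    rcases han.eventually_eq_zero_or_eventually_ne_zero with h | h
    · exact h
    · exfalso
      have h3 : ∀ᶠ s in 𝓝[≠] (0 : 𝕜), False := by
        filter_upwards [h, hw.filter_mono nhdsWithin_le_nhds,
          hsmall.filter_mono nhdsWithin_le_nhds, self_mem_nhdsWithin] with s a1 a2 a3 a4
        rw [X.ev_rec s a3, h0, zero_add] at a2
        rcases mul_eq_zero.1 a2 with h | h
        · exact a4 h
        · exact a1 h
      simp only [eventually_false_iff_eq_bot] at h3
      exact (NeBot.ne inferInstance) h3
  have all : ∀ n : ℕ, ∀ᶠ s in 𝓝 (0 : 𝕜), X.ev s ((X.L ^ n) v) = 0 := by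
    intro n
    induction n with
    | zero => simpa using hv
    | succ n ih =>
      have := (step _ ih).2
      rw [pow_succ']
      exact this
  exact X.sep v fun n => (step _ (all n)).1

/-- truncation -/
lemma ev_trunc (s : 𝕜) (hs : ‖s‖ < 1) (d : ℕ) (v : V) :
    X.ev s v = ∑ i ∈ Finset.range d, X.δ ((X.L ^ i) v) * s ^ i + s ^ d * X.ev s ((X.L ^ d) v) := by
  induction d with
  | zero => simp
  | succ d ih =>
    rw [ih, Finset.sum_range_succ, X.ev_rec s hs ((X.L ^ d) v), pow_succ' X.L,
      mul_apply_eq_comp]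
    ring

lemma ev_Spow (s : 𝕜) (hs : ‖s‖ < 1) (d : ℕ) (v : V) :
    X.ev s ((X.S ^ d) v) = s ^ d * X.ev s v := by
  induction d with
  | zero => simp
  | succ d ih =>
    rw [pow_succ', mul_apply_eq_comp, X.ev_S s hs, ih]; ring

lemma LSpow (d : ℕ) : X.L ^ d * X.S ^ d = 1 := by
  have h : X.L * X.S = 1 := by ext v; exact X.LS v
  induction d with
  | zero => simp
  | succ d ih =>
    rw [pow_succ, pow_succ', mul_assoc, ← mul_assoc X.L, h, one_mul, ih]

end ShiftData
end Shift
section Weierstrass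
open scoped BoundedContinuousFunction

lemma analyticAt_clm_apply {𝕜 : Type*} [RCLike 𝕜] {E F G : Type*} [NormedAddCommGroup E]
    [NormedSpace 𝕜 E] [NormedAddCommGroup F] [NormedSpace 𝕜 F] [NormedAddCommGroup G]
    [NormedSpace 𝕜 G] {f : E → (F →L[𝕜] G)} {v : E → F} {x : E} (hf : AnalyticAt 𝕜 f x)
    (hv : AnalyticAt 𝕜 v x) : AnalyticAt 𝕜 (fun x => f x (v x)) x :=
  AnalyticAt.fun_comp (g := fun p : (F →L[𝕜] G) × F => p.1 p.2) (f := fun x => (f x, v x))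
    ((ContinuousLinearMap.id 𝕜 (F →L[𝕜] G)).analyticAt_bilinear _) (hf.prod hv)

theorem weierstrass_aux {𝕜 : Type*} [RCLike 𝕜] {V : Type*} [NormedAddCommGroup V]
    [NormedSpace 𝕜 V] [CompleteSpace V] (X : ShiftData 𝕜 V) {E H : Type*} [NormedAddCommGroup E]
    [NormedSpace 𝕜 E] [FiniteDimensional 𝕜 E] [NormedAddCommGroup H] [NormedSpace 𝕜 H]
    (j : H →L[𝕜] E) (π : E →L[𝕜] H) (z : E →L[𝕜] 𝕜) (v0 : E)
    (hdec : ∀ p, p = j (π p) + z p • v0) (d : ℕ) (g h : E → 𝕜) (hg : AnalyticAt 𝕜 g 0)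
    (hh : AnalyticAt 𝕜 h 0) (hg0 : ∀ᶠ t in 𝓝 (0 : 𝕜), g (t • v0) = t ^ d) :
    ∃ (q : E → 𝕜) (r : ℕ → H → 𝕜), AnalyticAt 𝕜 q 0 ∧ (∀ i, AnalyticAt 𝕜 (r i) 0) ∧
      (∀ᶠ p in 𝓝 (0 : E), h p = q p * g p + ∑ i ∈ Finset.range d, r i (π p) * z p ^ i) ∧
      ((∀ᶠ t in 𝓝 (0 : 𝕜), h (t • v0) = 0) → q 0 = 0) := by
  let b := Module.finBasis 𝕜 E
  have : Nontrivial V := ⟨X.e, 0, fun h => by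
    have := X.δe
    rw [h, map_zero] at this
    exact zero_ne_one this⟩
  obtain ⟨Gg, r1, hr1, hGg, hGg'⟩ := fc_exists (A := V →L[𝕜] V) b g hg
  obtain ⟨Gh, r2, hr2, hGh, hGh'⟩ := fc_exists (A := V →L[𝕜] V) b h hh
  let r := min r1 r2
  have hr : 0 < r := lt_min hr1 hr2
  -- choice of the scale
  obtain ⟨ρ, hρ, hρ0⟩ : ∃ ρ : 𝕜, ‖(fun i => (b.repr v0 i * ρ) • X.S : _ → (V →L[𝕜] V))‖ < r ∧
      ρ ≠ 0 := by
    have hc : Continuous (fun ρ : 𝕜 => ‖(fun i => (b.repr v0 i * ρ) • X.S : _ → (V →L[𝕜] V))‖) := by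
      fun_prop
    have h1 : ∀ᶠ ρ in 𝓝 (0 : 𝕜), ‖(fun i => (b.repr v0 i * ρ) • X.S : _ → (V →L[𝕜] V))‖ < r := by
      refine hc.continuousAt.eventually_lt_const ?_
      simpa [← Pi.zero_def] using hr
    have h2 : ∀ᶠ ρ in 𝓝[≠] (0 : 𝕜),
        ‖(fun i => (b.repr v0 i * ρ) • X.S : _ → (V →L[𝕜] V))‖ < r ∧ ρ ≠ 0 :=
      (h1.filter_mono nhdsWithin_le_nhds).and self_mem_nhdsWithin
    exact h2.exists
  let co : ∀ i, E →L[𝕜] 𝕜 := fun i => (b.coord i).toContinuousLinearMap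
  let y : H → _ → (V →L[𝕜] V) := fun x i => co i (j x) • 1 + (b.repr v0 i * ρ) • X.S
  have hy0 : ‖y 0‖ < r := by simpa [y] using hρ
  have hyan : ∀ x, AnalyticAt 𝕜 y x := by
    intro x
    have : ∀ i, AnalyticAt 𝕜 (fun x => y x i) x := by
      intro i
      have h1 : AnalyticAt 𝕜 (fun x => co i (j x)) x := ((co i).comp j).analyticAt x
      exact (h1.smul analyticAt_const).add analyticAt_const
    exact AnalyticAt.pi this
  have hys : ∀ᶠ x in 𝓝 (0 : H), ‖y x‖ < r :=
    (hyan 0).continuousAt.norm.eventually_lt_const hy0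
  -- the evaluation property
  have hΛ : ∀ x s, ‖s‖ < 1 → ∀ (v : V) i (a : V →L[𝕜] V),
      ((X.ev s).comp (ContinuousLinearMap.id 𝕜 V)) ((y x i * a) v) =
        b.repr (j x + (ρ * s) • v0) i * X.ev s (a v) := by
    intro x s hs v i a
    have := X.ev_S s hs (a v)
    simp only [y, co, mul_apply_eq_comp, add_apply, smul_apply, one_apply_eq_self, map_add,
      map_smul, smul_eq_mul, ContinuousLinearMap.comp_id, this]
    simp
    ring
  have evg : ∀ x s, ‖s‖ < 1 → ‖y x‖ < r → ‖j x + (ρ * s) • v0‖ < r → ∀ v : V,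
      X.ev s (Gg (y x) v) = g (j x + (ρ * s) • v0) * X.ev s v := by
    intro x s hs hyx hc v
    have := hGg' (y x) (j x + (ρ * s) • v0) (hyx.trans_le (min_le_left _ _))
      (hc.trans_le (min_le_left _ _))
      ((X.ev s).comp (ContinuousLinearMap.apply 𝕜 V v)) (fun i a => hΛ x s hs v i a)
    simpa using this
  have evh : ∀ x s, ‖s‖ < 1 → ‖y x‖ < r → ‖j x + (ρ * s) • v0‖ < r → ∀ v : V,
      X.ev s (Gh (y x) v) = h (j x + (ρ * s) • v0) * X.ev s v := by
    intro x s hs hyx hc v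
    have := hGh' (y x) (j x + (ρ * s) • v0) (hyx.trans_le (min_le_right _ _))
      (hc.trans_le (min_le_right _ _))
      ((X.ev s).comp (ContinuousLinearMap.apply 𝕜 V v)) (fun i a => hΛ x s hs v i a)
    simpa using this
  have hsmall : ∀ᶠ s in 𝓝 (0 : 𝕜), ‖s‖ < 1 ∧ ‖j 0 + (ρ * s) • v0‖ < r := by
    have c1 : Continuous fun s : 𝕜 => ‖s‖ := by fun_prop
    have c2 : Continuous fun s : 𝕜 => ‖j 0 + (ρ * s) • v0‖ := by fun_prop
    exact (c1.continuousAt.eventually_lt_const (by simp)).and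
      (c2.continuousAt.eventually_lt_const (by simpa using hr))
  have htend : Tendsto (fun s : 𝕜 => ρ * s) (𝓝 0) (𝓝 0) := by
    have : Continuous fun s : 𝕜 => ρ * s := by fun_prop
    simpa using this.tendsto 0
  have hGg0 : Gg (y 0) = ρ ^ d • X.S ^ d := by
    ext1 v
    rw [← sub_eq_zero]
    apply X.ev_sep
    filter_upwards [hsmall, htend.eventually hg0] with s hs hgs
    rw [map_sub, evg 0 s hs.1 hy0 hs.2, smul_apply, map_smul, X.ev_Spow s hs.1, map_zero, zero_add,
      hgs, smul_eq_mul]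
    ring
  let P : V →L[𝕜] V := X.S ^ d * X.L ^ d
  have hLS := X.LSpow d
  have hPP : P * P = P := by
    simp only [P]
    rw [mul_assoc, ← mul_assoc (X.L ^ d), hLS, one_mul]
  let T : H → (V →L[𝕜] V) := fun x => Gg (y x) * X.L ^ d + (1 - P)
  have hT0 : T 0 = ρ ^ d • P + (1 - P) := by
    simp only [T, hGg0, P, smul_mul_assoc]
  have hpd : ρ ^ d ≠ 0 := pow_ne_zero _ hρ0
  have inv_aux : ∀ c c' : 𝕜, c * c' = 1 → (c • P + (1 - P)) * (c' • P + (1 - P)) = 1 := by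
    intro c c' hcc
    have : (c • P + (1 - P)) * (c' • P + (1 - P)) = (c * c') • (P * P) + c • (P - P * P)
      + c' • (P - P * P) + (1 - P - P + P * P) := by
      simp only [mul_add, add_mul, mul_sub, sub_mul, smul_mul_assoc, mul_smul_comm, smul_smul,
        mul_one, one_mul, smul_sub, smul_add, mul_comm c' c]
      abel
    rw [this, hPP, hcc]; simp
  let U : (V →L[𝕜] V)ˣ := ⟨T 0, (ρ ^ d)⁻¹ • P + (1 - P),
    by rw [hT0]; exact inv_aux _ _ (mul_inv_cancel₀ hpd),
    by rw [hT0]; exact inv_aux _ _ (inv_mul_cancel₀ hpd)⟩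
  have hGgan : AnalyticAt 𝕜 (fun x => Gg (y x)) 0 :=
    (hGg (y 0) (hy0.trans_le (min_le_left _ _))).fun_comp (hyan 0)
  have hGhan : AnalyticAt 𝕜 (fun x => Gh (y x)) 0 :=
    (hGh (y 0) (hy0.trans_le (min_le_right _ _))).fun_comp (hyan 0)
  have hTan : AnalyticAt 𝕜 T 0 := (hGgan.mul analyticAt_const).add analyticAt_const
  have hTinv : AnalyticAt 𝕜 (fun x => Ring.inverse (T x)) 0 :=
    AnalyticAt.fun_comp (analyticAt_inverse U) hTan
  have hTunit : ∀ᶠ x in 𝓝 (0 : H), IsUnit (T x) :=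
    hTan.continuousAt.eventually (Units.isOpen.mem_nhds U.isUnit)
  let w : H → V := fun x => Ring.inverse (T x) (Gh (y x) X.e)
  have hwan : AnalyticAt 𝕜 w 0 := analyticAt_clm_apply hTinv (analyticAt_clm_apply hGhan analyticAt_const)
  refine ⟨fun p => X.ev (ρ⁻¹ * z p) ((X.L ^ d) (w (π p))),
    fun i x => X.δ ((X.L ^ i) (w x)) * (ρ⁻¹) ^ i, ?_, ?_, ?_, ?_⟩
  · have a1 : AnalyticAt 𝕜 (fun p : E => X.ev (ρ⁻¹ * z p)) 0 := by
      refine AnalyticAt.fun_comp (g := X.ev) (f := fun p : E => ρ⁻¹ * z p) ?_ ?_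
      · exact X.ev_analytic _ (by simp)
      · exact analyticAt_const.mul (z.analyticAt _)
    have a2 : AnalyticAt 𝕜 (fun p : E => w (π p)) 0 := by
      refine AnalyticAt.fun_comp (g := w) (f := fun p : E => π p) ?_ (π.analyticAt _)
      simpa using hwan
    exact analyticAt_clm_apply a1 (((X.L ^ d).analyticAt _).fun_comp a2)
  · intro i
    exact ((X.δ.comp (X.L ^ i)).analyticAt _).fun_comp hwan |>.mul analyticAt_const
  · have hπ : Tendsto π (𝓝 0) (𝓝 0) := by simpa using π.continuous.tendsto 0
    have hzs : ∀ᶠ p in 𝓝 (0 : E), ‖ρ⁻¹ * z p‖ < 1 := by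
      have c1 : Continuous fun p : E => ‖ρ⁻¹ * z p‖ := by fun_prop
      exact c1.continuousAt.eventually_lt_const (by simp)
    have hps : ∀ᶠ p in 𝓝 (0 : E), ‖p‖ < r := by
      have c1 : Continuous fun p : E => ‖p‖ := by fun_prop
      exact c1.continuousAt.eventually_lt_const (by simpa using hr)
    filter_upwards [hπ.eventually hTunit, hπ.eventually hys, hzs, hps] with p h1 h2 h3 h4
    set s := ρ⁻¹ * z p with hs
    have hρs : ρ * s = z p := by rw [hs, mul_inv_cancel_left₀ hρ0]
    have hpp : j (π p) + (ρ * s) • v0 = p := by rw [hρs]; exact (hdec p).symm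
    have e1 : T (π p) (w (π p)) = Gh (y (π p)) X.e := by
      have := Ring.mul_inverse_cancel _ h1
      have := congrArg (fun B : V →L[𝕜] V => B (Gh (y (π p)) X.e)) this
      simpa [mul_apply_eq_comp] using this
    have e2 := congrArg (X.ev s) e1
    rw [evh _ s h3 h2 (by rw [hpp]; exact h4), X.ev_e s h3, hpp, mul_one] at e2
    rw [← e2]
    simp only [T, P, add_apply, sub_apply, mul_apply_eq_comp, one_apply_eq_self, map_add, map_sub]
    rw [evg _ s h3 h2 (by rw [hpp]; exact h4), hpp, X.ev_Spow s h3, X.ev_trunc s h3 d (w (π p))]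
    have : ∀ i ∈ Finset.range d, X.δ ((X.L ^ i) (w (π p))) * (ρ⁻¹) ^ i * z p ^ i
        = X.δ ((X.L ^ i) (w (π p))) * s ^ i := by
      intro i _
      rw [hs, mul_pow]; ring
    rw [Finset.sum_congr rfl this]
    ring
  · intro h0
    have : Gh (y 0) = 0 := by
      ext1 v
      apply X.ev_sep
      filter_upwards [hsmall, htend.eventually h0] with s hs hgs
      rw [evh 0 s hs.1 hy0 hs.2, map_zero, zero_add, hgs, zero_mul]
    have hw : w 0 = 0 := by simp [w, this]
    simp [hw]

theorem weierstrass_div {𝕜 : Type*} [RCLike 𝕜] {E H : Type*} [NormedAddCommGroup E]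
    [NormedSpace 𝕜 E] [FiniteDimensional 𝕜 E] [NormedAddCommGroup H] [NormedSpace 𝕜 H]
    (j : H →L[𝕜] E) (π : E →L[𝕜] H) (z : E →L[𝕜] 𝕜) (v0 : E)
    (hdec : ∀ p, p = j (π p) + z p • v0) (d : ℕ) (g h : E → 𝕜) (hg : AnalyticAt 𝕜 g 0)
    (hh : AnalyticAt 𝕜 h 0) (hg0 : ∀ᶠ t in 𝓝 (0 : 𝕜), g (t • v0) = t ^ d) :
    ∃ (q : E → 𝕜) (r : ℕ → H → 𝕜), AnalyticAt 𝕜 q 0 ∧ (∀ i, AnalyticAt 𝕜 (r i) 0) ∧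
      (∀ᶠ p in 𝓝 (0 : E), h p = q p * g p + ∑ i ∈ Finset.range d, r i (π p) * z p ^ i) ∧
      ((∀ᶠ t in 𝓝 (0 : 𝕜), h (t • v0) = 0) → q 0 = 0) :=
  weierstrass_aux (shiftBCF 𝕜) j π z v0 hdec d g h hg hh hg0
end Weierstrass
section Alg
open Polynomial TensorProduct

lemma der_ext {𝕜 L : Type u} [Field 𝕜] [CharZero 𝕜] [Field L] [Algebra 𝕜 L] (R : Subalgebra 𝕜 L)
    [Algebra.IsAlgebraic R L] (D0 : Derivation 𝕜 R L) :
    ∃ D : Derivation 𝕜 L L, ∀ x : R, D (x : L) = D0 x := by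
  let M := FractionRing R
  have hinj : Function.Injective (algebraMap R L) := Subtype.val_injective
  have : FaithfulSMul R L := (faithfulSMul_iff_algebraMap_injective R L).2 hinj
  let _ : Algebra M L := FractionRing.liftAlgebra R L
  have : IsScalarTower R M L := FractionRing.isScalarTower_liftAlgebra R L
  have : Algebra.IsAlgebraic M L := (IsFractionRing.comap_isAlgebraic_iff (A := R) (K := M) (C := L)).1 inferInstance
  have : CharZero L := charZero_of_injective_algebraMap (algebraMap 𝕜 L).injective
  have : CharZero R := charZero_of_injective_algebraMap (R := 𝕜) (A := R) (algebraMap 𝕜 R).injective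
  have : CharZero M := charZero_of_injective_algebraMap (IsFractionRing.injective R M)
  have : Algebra.FormallyEtale R M := Algebra.FormallyEtale.of_isLocalization (nonZeroDivisors R)
  have : Algebra.IsSeparable M L := inferInstance
  have : Algebra.FormallyEtale M L := Algebra.FormallyEtale.of_isSeparable M L
  have : Algebra.FormallyEtale R L := Algebra.FormallyEtale.comp R M L
  let e := KaehlerDifferential.tensorKaehlerEquivOfFormallyEtale 𝕜 R L
  let ℓ : Ω[L⁄𝕜] →ₗ[L] L := (LinearMap.liftBaseChange L D0.liftKaehlerDifferential) ∘ₗ e.symm.toLinearMap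
  refine ⟨ℓ.compDer (KaehlerDifferential.D 𝕜 L), fun x => ?_⟩
  have := KaehlerDifferential.tensorKaehlerEquivOfFormallyEtale_symm_D_algebraMap 𝕜 R L x
  show ℓ (KaehlerDifferential.D 𝕜 L (algebraMap R L x)) = _
  simp only [ℓ, LinearMap.comp_apply, LinearEquiv.coe_coe, e]
  rw [this]
  simp

lemma alg_const {𝕜 L : Type u} [Field 𝕜] [CharZero 𝕜] [Field L] [Algebra 𝕜 L] (R : Subalgebra 𝕜 L)
    [Algebra.IsAlgebraic R L] (Ds : Set (Derivation 𝕜 L L)) (hR : ∀ D ∈ Ds, ∀ x ∈ R, D x ∈ R)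
    (hconst : ∀ x ∈ R, ∀ y ∈ R, y ≠ 0 → (∀ D ∈ Ds, y * D x = x * D y) → ∃ k : 𝕜, x = k • y)
    (a : L) (ha : ∀ D ∈ Ds, D a = 0) : IsAlgebraic 𝕜 a := by
  let M := FractionRing R
  have hinj : Function.Injective (algebraMap R L) := Subtype.val_injective
  have : FaithfulSMul R L := (faithfulSMul_iff_algebraMap_injective R L).2 hinj
  let _ : Algebra M L := FractionRing.liftAlgebra R L
  have : IsScalarTower R M L := FractionRing.isScalarTower_liftAlgebra R L
  have : Algebra.IsAlgebraic M L := (IsFractionRing.comap_isAlgebraic_iff (A := R) (K := M) (C := L)).1 inferInstance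
  have hrep : ∀ m : M, ∃ x y : R, (y : L) ≠ 0 ∧ algebraMap M L m * y = x := by
    intro m
    obtain ⟨x, y, hy, hm⟩ := IsFractionRing.div_surjective (A := R) m
    have hy0 : (y : L) ≠ 0 := by
      intro h
      exact nonZeroDivisors.ne_zero hy (Subtype.ext h)
    refine ⟨x, y, hy0, ?_⟩
    rw [← hm, map_div₀, ← IsScalarTower.algebraMap_apply, ← IsScalarTower.algebraMap_apply]
    exact div_mul_cancel₀ _ hy0
  have hrep' : ∀ x y : R, ∃ m : M, algebraMap M L m = (x : L) / y := by
    intro x y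
    refine ⟨algebraMap R M x / algebraMap R M y, ?_⟩
    rw [map_div₀, ← IsScalarTower.algebraMap_apply, ← IsScalarTower.algebraMap_apply]
    rfl
  have hDM : ∀ D ∈ Ds, ∀ m : M, ∃ m' : M, algebraMap M L m' = D (algebraMap M L m) := by
    intro D hD m
    obtain ⟨x, y, hy, hm⟩ := hrep m
    have h1 : D (algebraMap M L m) = ((y : L) * D x - x * D y) / (y * y) := by
      have h2 := congrArg D hm
      rw [Derivation.leibniz, smul_eq_mul, smul_eq_mul] at h2
      rw [eq_div_iff (mul_ne_zero hy hy), ← h2, ← hm]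
      ring
    rw [h1]
    obtain ⟨m', hm'⟩ := hrep' (y * ⟨D x, hR D hD x x.2⟩ - x * ⟨D y, hR D hD y y.2⟩) (y * y)
    exact ⟨m', hm'⟩
  have hintg : IsIntegral M a := (Algebra.IsAlgebraic.isAlgebraic (R := M) a).isIntegral
  set p := minpoly M a with hp
  have hmonic := minpoly.monic hintg
  have hcoef : ∀ D ∈ Ds, ∀ i, D (algebraMap M L (p.coeff i)) = 0 := by
    intro D hD
    choose F hF using hDM D hD
    let q : M[X] := ∑ i ∈ Finset.range p.natDegree, C (F (p.coeff i)) * X ^ i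
    have hq0 : aeval a q = 0 := by
      have h0 : aeval a p = 0 := minpoly.aeval M a
      rw [aeval_eq_sum_range] at h0
      have h1 := congrArg D h0
      rw [map_zero, map_sum, Finset.sum_range_succ] at h1
      have h2 : ∀ i, D (p.coeff i • a ^ i) = D (algebraMap M L (p.coeff i)) * a ^ i := by
        intro i
        rw [Algebra.smul_def, Derivation.leibniz, Derivation.leibniz_pow, ha D hD]
        simp [mul_comm]
      simp only [h2] at h1
      rw [show p.coeff p.natDegree = 1 from hmonic, map_one, Derivation.map_one_eq_zero, zero_mul,
        add_zero] at h1
      simp only [q, map_sum, map_mul, aeval_C, map_pow, aeval_X, hF]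
      exact h1
    have hqdeg : q.degree < p.degree := by
      rw [degree_eq_natDegree hmonic.ne_zero]
      refine (degree_sum_le _ _).trans_lt ?_
      rw [Finset.sup_lt_iff (WithBot.bot_lt_coe _)]
      intro i hi
      refine (degree_C_mul_X_pow_le _ _).trans_lt ?_
      exact_mod_cast Finset.mem_range.1 hi
    have hq : q = 0 := by
      by_contra h
      exact absurd (minpoly.degree_le_of_ne_zero M a h hq0) (not_le.2 hqdeg)
    intro i
    rcases lt_trichotomy i p.natDegree with h | h | h
    · have := congrArg (fun q : M[X] => q.coeff i) hq
      simp only [q, finset_sum_coeff, coeff_C_mul_X_pow, coeff_zero] at this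
      rw [Finset.sum_ite_eq] at this
      simp only [Finset.mem_range, h, if_true] at this
      rw [← hF, this, map_zero]
    · rw [h, show p.coeff p.natDegree = 1 from hmonic, map_one, Derivation.map_one_eq_zero]
    · rw [coeff_eq_zero_of_natDegree_lt h, map_zero, map_zero]
  have hk : ∀ i, ∃ k : 𝕜, algebraMap 𝕜 L k = algebraMap M L (p.coeff i) := by
    intro i
    obtain ⟨x, y, hy, hm⟩ := hrep (p.coeff i)
    obtain ⟨k, hk⟩ := hconst x x.2 y y.2 hy (by
      intro D hD
      have h2 := congrArg D hm
      rw [Derivation.leibniz, smul_eq_mul, smul_eq_mul, hcoef D hD i, mul_zero, add_zero] at h2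
      rw [← h2, ← hm]; ring)
    refine ⟨k, ?_⟩
    rw [hk, Algebra.smul_def] at hm
    exact (mul_right_cancel₀ hy hm).symm
  have hl : p.map (algebraMap M L) ∈ Polynomial.lifts (algebraMap 𝕜 L) := by
    rw [Polynomial.lifts_iff_coeff_lifts]
    intro i
    rw [coeff_map]
    exact hk i
  obtain ⟨P, hP⟩ := (Polynomial.mem_lifts _).1 hl
  refine ⟨P, ?_, ?_⟩
  · intro h
    rw [h, Polynomial.map_zero] at hP
    exact hmonic.ne_zero ((Polynomial.map_eq_zero _).1 hP.symm)
  · rw [← eval_map_algebraMap, hP, eval_map_algebraMap, minpoly.aeval]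
end Alg
section Germ
variable {𝕜 : Type u} [RCLike 𝕜]

/-- Functions analytic at the origin. -/
def An (𝕜 : Type u) [RCLike 𝕜] (E : Type u) [NormedAddCommGroup E] [NormedSpace 𝕜 E] :
    Subalgebra 𝕜 (E → 𝕜) where
  carrier := {f | AnalyticAt 𝕜 f 0}
  mul_mem' := fun ha hb => AnalyticAt.mul ha hb
  add_mem' := fun ha hb => AnalyticAt.add ha hb
  algebraMap_mem' := fun _ => analyticAt_const

variable {E : Type u} [NormedAddCommGroup E] [NormedSpace 𝕜 E]

/-- Directional derivative. -/
noncomputable def dv (v : E) (f : An 𝕜 E) : An 𝕜 E :=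
  ⟨fun p => fderiv 𝕜 f.1 p v, by
    have h : AnalyticAt 𝕜 (fderiv 𝕜 f.1) 0 := AnalyticAt.fderiv f.2
    exact ((ContinuousLinearMap.apply 𝕜 𝕜 v).analyticAt _).comp h⟩

lemma dv_apply (v : E) (f : An 𝕜 E) (p : E) : (dv v f).1 p = fderiv 𝕜 f.1 p v := rfl

lemma an_diff (f : An 𝕜 E) : ∀ᶠ p in 𝓝 (0 : E), DifferentiableAt 𝕜 f.1 p :=
  (AnalyticAt.eventually_analyticAt f.2).mono fun _ h => h.differentiableAt

lemma dv_congr (v : E) {f g : An 𝕜 E} (h : f.1 =ᶠ[𝓝 0] g.1) : (dv v f).1 =ᶠ[𝓝 0] (dv v g).1 := by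
  filter_upwards [h.fderiv (𝕜 := 𝕜)] with p hp
  rw [dv_apply, dv_apply, hp]

lemma dv_add (v : E) (f g : An 𝕜 E) : (dv v (f + g)).1 =ᶠ[𝓝 0] (dv v f + dv v g).1 := by
  filter_upwards [an_diff f, an_diff g] with p hf hg
  show fderiv 𝕜 (f.1 + g.1) p v = fderiv 𝕜 f.1 p v + fderiv 𝕜 g.1 p v
  rw [fderiv_add hf hg]; rfl

lemma dv_mul (v : E) (f g : An 𝕜 E) :
    (dv v (f * g)).1 =ᶠ[𝓝 0] (f * dv v g + g * dv v f).1 := by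
  filter_upwards [an_diff f, an_diff g] with p hf hg
  show fderiv 𝕜 (f.1 * g.1) p v = f.1 p * fderiv 𝕜 g.1 p v + g.1 p * fderiv 𝕜 f.1 p v
  rw [fderiv_mul hf hg]; rfl

lemma dv_const (v : E) (c : 𝕜) : dv v (algebraMap 𝕜 (An 𝕜 E) c) = 0 := by
  apply Subtype.ext
  funext p
  show fderiv 𝕜 (fun _ : E => c) p v = 0
  simp

variable {L : Type u} [Field L] [Algebra 𝕜 L]

/-- `φ` factors through germs. -/
def GermHom (φ : An 𝕜 E →ₐ[𝕜] L) : Prop := ∀ f : An 𝕜 E, f.1 =ᶠ[𝓝 0] 0 → φ f = 0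

lemma GermHom.congr {φ : An 𝕜 E →ₐ[𝕜] L} (hφ : GermHom φ) {f g : An 𝕜 E}
    (h : f.1 =ᶠ[𝓝 0] g.1) : φ f = φ g := by
  rw [← sub_eq_zero, ← map_sub]
  apply hφ
  filter_upwards [h] with p hp
  show f.1 p - g.1 p = 0
  rw [hp, sub_self]

/-- Derivation-like maps over `φ`, as a submodule. -/
def DerOver (φ : An 𝕜 E →ₐ[𝕜] L) : Submodule L (An 𝕜 E → L) where
  carrier := {X | (∀ f g, X (f + g) = X f + X g) ∧ (∀ f g, X (f * g) = φ f * X g + φ g * X f) ∧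
    (∀ f g : An 𝕜 E, f.1 =ᶠ[𝓝 0] g.1 → X f = X g)}
  add_mem' := by
    rintro X Y ⟨h1, h2, h3⟩ ⟨k1, k2, k3⟩
    refine ⟨fun f g => ?_, fun f g => ?_, fun f g h => ?_⟩
    · simp only [Pi.add_apply, h1, k1]; ring
    · simp only [Pi.add_apply, h2, k2]; ring
    · simp only [Pi.add_apply, h3 f g h, k3 f g h]
  zero_mem' := by
    refine ⟨fun f g => ?_, fun f g => ?_, fun f g h => rfl⟩ <;> simp
  smul_mem' := by
    rintro c X ⟨h1, h2, h3⟩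
    refine ⟨fun f g => ?_, fun f g => ?_, fun f g h => ?_⟩
    · simp only [Pi.smul_apply, h1, smul_eq_mul]; ring
    · simp only [Pi.smul_apply, h2, smul_eq_mul]; ring
    · simp only [Pi.smul_apply, h3 f g h]

lemma DerOver.sum {φ : An 𝕜 E →ₐ[𝕜] L} {X : An 𝕜 E → L} (hX : X ∈ DerOver φ) {ι : Type*}
    (s : Finset ι) (a : ι → An 𝕜 E) (ha : ∀ i ∈ s, X (a i) = 0) : X (∑ i ∈ s, a i) = 0 := by
  classical
  have h0 : X 0 = 0 := by simpa using hX.1 0 0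
  induction s using Finset.induction_on with
  | empty => simpa using h0
  | insert i s hi ih =>
    rw [Finset.sum_insert hi, hX.1, ha i (by simp), ih fun k hk => ha k (by simp [hk]), add_zero]

lemma DerOver.mul0 {φ : An 𝕜 E →ₐ[𝕜] L} {X : An 𝕜 E → L} (hX : X ∈ DerOver φ) {f g : An 𝕜 E}
    (hf : X f = 0) (hg : X g = 0) : X (f * g) = 0 := by
  rw [hX.2.1, hf, hg]; simp

lemma DerOver.pow0 {φ : An 𝕜 E →ₐ[𝕜] L} {X : An 𝕜 E → L} (hX : X ∈ DerOver φ) {f : An 𝕜 E}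
    (hf : X f = 0) (n : ℕ) : X (f ^ n) = 0 := by
  induction n with
  | zero =>
    have := hX.2.1 1 1
    simp at this
    simpa using this
  | succ n ih => rw [pow_succ]; exact DerOver.mul0 hX ih hf

/-- Span of the coordinate vector fields. -/
noncomputable def vf (φ : An 𝕜 E →ₐ[𝕜] L) : Submodule L (An 𝕜 E → L) :=
  Submodule.span L (range fun (v : E) (f : An 𝕜 E) => φ (dv v f))

lemma dv_mem_vf (φ : An 𝕜 E →ₐ[𝕜] L) (v : E) : (fun f => φ (dv v f)) ∈ vf φ :=
  Submodule.subset_span ⟨v, rfl⟩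

lemma vf_le {φ : An 𝕜 E →ₐ[𝕜] L} (hφ : GermHom φ) : vf φ ≤ DerOver φ := by
  refine Submodule.span_le.2 ?_
  rintro _ ⟨v, rfl⟩
  refine ⟨fun f g => ?_, fun f g => ?_, fun f g h => hφ.congr (dv_congr v h)⟩
  · simp only [← map_add]; exact hφ.congr (dv_add v f g)
  · simp only [← map_add, ← map_mul]; exact hφ.congr (dv_mul v f g)

/-- Derivations induced by vector fields. -/
def Good (φ : An 𝕜 E →ₐ[𝕜] L) (D : Derivation 𝕜 L L) : Prop := (fun f => D (φ f)) ∈ vf φ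

lemma der_mem {φ : An 𝕜 E →ₐ[𝕜] L} (hφ : GermHom φ) (D : Derivation 𝕜 L L) :
    (fun f => D (φ f)) ∈ DerOver φ := by
  refine ⟨fun f g => by simp, fun f g => ?_, fun f g h => ?_⟩
  · simp only [map_mul, Derivation.leibniz, smul_eq_mul]
  · simp only [hφ.congr h]

/-- The algebraicity property. -/
def TProp (𝕜 : Type u) [RCLike 𝕜] (E : Type u) [NormedAddCommGroup E] [NormedSpace 𝕜 E] : Prop :=
  ∀ (L : Type u) [Field L] [Algebra 𝕜 L] (φ : An 𝕜 E →ₐ[𝕜] L), GermHom φ →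
    Algebra.IsAlgebraic φ.range L → ∀ a : L, (∀ D, Good φ D → D a = 0) → IsAlgebraic 𝕜 a

lemma const_of_log {f g : An 𝕜 E} (hg : ¬ g.1 =ᶠ[𝓝 0] 0)
    (h : ∀ v, ∀ᶠ p in 𝓝 (0 : E), g.1 p * (dv v f).1 p = f.1 p * (dv v g).1 p)
    [FiniteDimensional 𝕜 E] : ∃ k : 𝕜, ∀ᶠ p in 𝓝 (0 : E), f.1 p = k * g.1 p := by
  have hall : ∀ᶠ p in 𝓝 (0 : E), ∀ v, g.1 p * fderiv 𝕜 f.1 p v = f.1 p * fderiv 𝕜 g.1 p v := by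
    let b := Module.finBasis 𝕜 E
    have : ∀ᶠ p in 𝓝 (0 : E), ∀ i, g.1 p * fderiv 𝕜 f.1 p (b i) = f.1 p * fderiv 𝕜 g.1 p (b i) :=
      eventually_all.2 fun i => h (b i)
    filter_upwards [this] with p hp v
    have : (g.1 p • (fderiv 𝕜 f.1 p : E →ₗ[𝕜] 𝕜)) = f.1 p • (fderiv 𝕜 g.1 p : E →ₗ[𝕜] 𝕜) :=
      b.ext fun i => by simpa using hp i
    simpa using LinearMap.congr_fun this v
  have hev := hall.and ((AnalyticAt.eventually_analyticAt f.2).and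
    (AnalyticAt.eventually_analyticAt g.2))
  obtain ⟨r, hr, hball⟩ := Metric.eventually_nhds_iff_ball.1 hev
  have : ∃ p ∈ ball (0 : E) r, g.1 p ≠ 0 := by
    by_contra hcon
    push Not at hcon
    exact hg (Filter.eventuallyEq_of_mem (ball_mem_nhds 0 hr) hcon)
  obtain ⟨p0, hp0, hgp0⟩ := this
  have hcont : ContinuousAt g.1 p0 := (hball p0 hp0).2.2.continuousAt
  have hev2 : ∀ᶠ p in 𝓝 p0, g.1 p ≠ 0 ∧ p ∈ ball (0 : E) r :=
    (hcont.eventually_ne hgp0).and (isOpen_ball.mem_nhds hp0)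
  obtain ⟨s, hs, hball2⟩ := Metric.eventually_nhds_iff_ball.1 hev2
  refine ⟨f.1 p0 / g.1 p0, ?_⟩
  have hderiv : ∀ p ∈ ball p0 s, HasFDerivWithinAt (fun p => f.1 p / g.1 p) (0 : E →L[𝕜] 𝕜) (ball p0 s) p := by
    intro p hp
    obtain ⟨h1, h2, h3⟩ := hball p (hball2 p hp).2
    have hgp := (hball2 p hp).1
    have hd := h2.differentiableAt.hasFDerivAt.mul
      ((hasDerivAt_inv hgp).comp_hasFDerivAt p h3.differentiableAt.hasFDerivAt)
    refine HasFDerivAt.hasFDerivWithinAt ?_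
    have he : (fun p => f.1 p / g.1 p) = f.1 * (Inv.inv ∘ g.1) := by
      funext q; simp [div_eq_mul_inv]
    rw [he]
    refine hd.congr_fderiv ?_
    refine ContinuousLinearMap.ext fun v => ?_
    have h4 := h1 v
    simp
    field_simp
    linear_combination h4
  have hloc : ∀ p ∈ ball p0 s, f.1 p / g.1 p = f.1 p0 / g.1 p0 := by
    intro p hp
    let : NormedSpace ℝ E := NormedSpace.restrictScalars ℝ 𝕜 E
    exact (convex_ball p0 s).is_const_of_fderivWithin_eq_zero (𝕜 := 𝕜)
      (fun q hq => (hderiv q hq).differentiableWithinAt)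
      (fun q hq => (hderiv q hq).fderivWithin (isOpen_ball.uniqueDiffWithinAt hq)) hp
      (mem_ball_self hs)
  have hid := AnalyticOnNhd.eqOn_zero_of_preconnected_of_eventuallyEq_zero (𝕜 := 𝕜)
    (f := fun p => f.1 p - f.1 p0 / g.1 p0 * g.1 p) (U := ball (0 : E) r) (z₀ := p0)
    (fun p hp => ((hball p hp).2.1).sub (analyticAt_const.mul (hball p hp).2.2))
    (by
      let : NormedSpace ℝ E := NormedSpace.restrictScalars ℝ 𝕜 E
      exact (convex_ball (0 : E) r).isPreconnected) hp0
    (by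
      filter_upwards [ball_mem_nhds p0 hs] with p hp
      have := hloc p hp
      have h2 := (hball2 p hp).1
      show f.1 p - f.1 p0 / g.1 p0 * g.1 p = 0
      rw [← this, div_mul_cancel₀ _ h2, sub_self])
  filter_upwards [ball_mem_nhds (0 : E) hr] with p hp
  exact sub_eq_zero.1 (hid hp)

lemma tprop_inj [FiniteDimensional 𝕜 E] (φ : An 𝕜 E →ₐ[𝕜] L) (hφ : GermHom φ)
    (halg : Algebra.IsAlgebraic φ.range L) (hinj : ∀ f, φ f = 0 → f.1 =ᶠ[𝓝 0] 0) (a : L)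
    (ha : ∀ D, Good φ D → D a = 0) : IsAlgebraic 𝕜 a := by
  have hinj' : ∀ f g, φ f = φ g → f.1 =ᶠ[𝓝 0] g.1 := by
    intro f g h
    have := hinj (f - g) (by rw [map_sub, h, sub_self])
    filter_upwards [this] with p hp
    exact sub_eq_zero.1 hp
  choose pre hpre using fun x : φ.range => (AlgHom.mem_range φ).1 x.2
  have key : ∀ v (x : φ.range) (f : An 𝕜 E), (x : L) = φ f → φ (dv v (pre x)) = φ (dv v f) := by
    intro v x f h
    exact hφ.congr (dv_congr v (hinj' _ _ ((hpre x).trans h)))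
  have hD0 : ∀ v, ∃ D : Derivation 𝕜 L L, ∀ f, D (φ f) = φ (dv v f) := by
    intro v
    have hX := vf_le hφ (dv_mem_vf φ v)
    let lin : φ.range →ₗ[𝕜] L :=
      { toFun := fun x => φ (dv v (pre x))
        map_add' := by
          intro x y
          rw [key v (x + y) (pre x + pre y) (by simp [hpre])]
          exact hX.1 _ _
        map_smul' := by
          intro c x
          rw [key v (c • x) (algebraMap 𝕜 _ c * pre x) (by simp [hpre, Algebra.smul_def])]
          refine (hX.2.1 _ _).trans ?_
          simp [dv_const, Algebra.smul_def] }
    let D0 : Derivation 𝕜 φ.range L := Derivation.mk' lin (by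
      intro x y
      show φ (dv v (pre (x * y))) = (x : L) * φ (dv v (pre y)) + (y : L) * φ (dv v (pre x))
      rw [key v (x * y) (pre x * pre y) (by simp [hpre])]
      refine (hX.2.1 _ _).trans ?_
      simp only [hpre])
    obtain ⟨D, hD⟩ := der_ext φ.range D0
    refine ⟨D, fun f => ?_⟩
    rw [hD ⟨φ f, f, rfl⟩]
    exact key v ⟨φ f, f, rfl⟩ f rfl
  choose Dv hDv using hD0
  have hgood : ∀ v, Good φ (Dv v) := by
    intro v
    have : (fun f => Dv v (φ f)) = fun f => φ (dv v f) := funext (hDv v)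
    unfold Good
    rw [this]
    exact dv_mem_vf φ v
  refine alg_const φ.range (range Dv) ?_ ?_ a ?_
  · rintro _ ⟨v, rfl⟩ _ ⟨f, rfl⟩
    exact ⟨dv v f, (hDv v f).symm⟩
  · rintro _ ⟨f, rfl⟩ _ ⟨g, rfl⟩ hy hD
    have hg : ¬ g.1 =ᶠ[𝓝 0] 0 := fun h => hy (hφ g h)
    obtain ⟨k, hk⟩ := const_of_log (f := f) hg (by
      intro v
      have := hD (Dv v) ⟨v, rfl⟩
      have h2 : φ (g * dv v f) = φ (f * dv v g) := by
        rw [map_mul, map_mul, ← hDv, ← hDv]; exact this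
      exact hinj' _ _ h2)
    refine ⟨k, ?_⟩
    have : φ f = φ (k • g) := hφ.congr hk
    exact this.trans (map_smul φ k g)
  · rintro _ ⟨v, rfl⟩
    exact ha _ (hgood v)

lemma exists_regular {g : An 𝕜 E} (hg : ¬ g.1 =ᶠ[𝓝 0] 0) :
    ∃ v0 : E, ¬ ∀ᶠ t in 𝓝 (0 : 𝕜), g.1 (t • v0) = 0 := by
  by_contra hcon
  push Not at hcon
  apply hg
  obtain ⟨r, hr, hball⟩ := Metric.eventually_nhds_iff_ball.1 (AnalyticAt.eventually_analyticAt g.2)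
  filter_upwards [ball_mem_nhds (0 : E) hr] with p hp
  have hconv : IsPreconnected {t : 𝕜 | t • p ∈ ball (0 : E) r} := by
    let _ : NormedSpace ℝ E := NormedSpace.restrictScalars ℝ 𝕜 E
    have : IsScalarTower ℝ 𝕜 E := inferInstance
    have h1 : Convex ℝ (ball (0 : E) r) := convex_ball 0 r
    have h2 := h1.linear_preimage (((LinearMap.toSpanSingleton 𝕜 E p).restrictScalars ℝ))
    exact h2.isPreconnected
  have hid := AnalyticOnNhd.eqOn_zero_of_preconnected_of_eventuallyEq_zero (𝕜 := 𝕜)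
    (f := fun t : 𝕜 => g.1 (t • p)) (U := {t : 𝕜 | t • p ∈ ball (0 : E) r}) (z₀ := 0)
    (fun t ht => (hball _ ht).comp_of_eq
      (((ContinuousLinearMap.toSpanSingleton 𝕜 p).analyticAt t)) (by simp)) hconv
    (by simpa using hr) (hcon p)
  have h1 : (1 : 𝕜) ∈ {t : 𝕜 | t • p ∈ ball (0 : E) r} := by simpa using hp
  simpa using hid h1

lemma GermHom.ne_zero {φ : An 𝕜 E →ₐ[𝕜] L} (hφ : GermHom φ) {f : An 𝕜 E} (hf : f.1 0 ≠ 0) :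
    φ f ≠ 0 := by
  intro h
  let f' : An 𝕜 E := ⟨fun p => (f.1 p)⁻¹, AnalyticAt.inv f.2 hf⟩
  have h1 : φ (f * f') = φ 1 := by
    apply hφ.congr
    have hc : ContinuousAt f.1 0 := AnalyticAt.continuousAt f.2
    filter_upwards [hc.eventually_ne hf] with p hp
    exact mul_inv_cancel₀ hp
  rw [map_mul, h, zero_mul, map_one] at h1
  exact zero_ne_one h1

variable {H : Type u} [NormedAddCommGroup H] [NormedSpace 𝕜 H]

/-- Pull back along a linear map. -/
def pull (π : E →L[𝕜] H) : An 𝕜 H →ₐ[𝕜] An 𝕜 E where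
  toFun f := ⟨fun p => f.1 (π p), AnalyticAt.comp_of_eq f.2 (π.analyticAt 0) (map_zero π)⟩
  map_one' := rfl
  map_mul' _ _ := rfl
  map_zero' := rfl
  map_add' _ _ := rfl
  commutes' _ := rfl

lemma dv_pull (π : E →L[𝕜] H) (v : E) (f : An 𝕜 H) :
    (dv v (pull π f)).1 =ᶠ[𝓝 0] (pull π (dv (π v) f)).1 := by
  have hc : Tendsto π (𝓝 0) (𝓝 0) := by simpa using π.continuous.tendsto 0
  filter_upwards [hc.eventually (an_diff f)] with p hp
  show fderiv 𝕜 (f.1 ∘ π) p v = fderiv 𝕜 f.1 (π p) (π v)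
  rw [fderiv_comp p hp π.differentiableAt]
  simp

/-- A linear coordinate. -/
def lc (z : E →L[𝕜] 𝕜) : An 𝕜 E := ⟨fun p => z p, z.analyticAt 0⟩

lemma dv_lc (z : E →L[𝕜] 𝕜) (v : E) : dv v (lc z) = algebraMap 𝕜 _ (z v) := by
  apply Subtype.ext
  funext p
  show fderiv 𝕜 (fun p => z p) p v = z v
  simp

lemma GermHom.pull {φ : An 𝕜 E →ₐ[𝕜] L} (hφ : GermHom φ) (π : E →L[𝕜] H) :
    GermHom (φ.comp (pull π)) := by
  intro f hf
  apply hφ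
  have hc : Tendsto π (𝓝 0) (𝓝 0) := by simpa using π.continuous.tendsto 0
  exact hc.eventually hf

section Core
variable (j : H →L[𝕜] E) (π : E →L[𝕜] H) (z : E →L[𝕜] 𝕜) (v0 : E)

lemma div_an [FiniteDimensional 𝕜 E] (hdec : ∀ p, p = j (π p) + z p • v0) (d : ℕ) (g h : An 𝕜 E)
    (hg0 : ∀ᶠ t in 𝓝 (0 : 𝕜), g.1 (t • v0) = t ^ d) :
    ∃ (q : An 𝕜 E) (r : ℕ → An 𝕜 H),
      h.1 =ᶠ[𝓝 0] (q * g + ∑ i ∈ Finset.range d, pull π (r i) * lc z ^ i).1 ∧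
      ((∀ᶠ t in 𝓝 (0 : 𝕜), h.1 (t • v0) = 0) → q.1 0 = 0) := by
  obtain ⟨q, r, hq, hr, h1, h2⟩ := weierstrass_div j π z v0 hdec d g.1 h.1 g.2 h.2 hg0
  refine ⟨⟨q, hq⟩, fun i => ⟨r i, hr i⟩, ?_, h2⟩
  filter_upwards [h1] with p hp
  rw [hp]
  have : ((⟨q, hq⟩ * g + ∑ i ∈ Finset.range d, pull π ⟨r i, hr i⟩ * lc z ^ i : An 𝕜 E)).1
      = q * g.1 + ∑ i ∈ Finset.range d, (fun p => r i (π p)) * (fun p => z p) ^ i := by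
    rw [Subalgebra.coe_add, AddSubmonoidClass.coe_finsetSum]; rfl
  rw [this]
  simp

lemma monic_an [FiniteDimensional 𝕜 E] (hdec : ∀ p, p = j (π p) + z p • v0) (hz : z v0 = 1)
    (d : ℕ) (g : An 𝕜 E) (hg0 : ∀ᶠ t in 𝓝 (0 : 𝕜), g.1 (t • v0) = t ^ d) :
    ∃ (q : An 𝕜 E) (r : ℕ → An 𝕜 H), q.1 0 ≠ 0 ∧
      (lc z ^ d).1 =ᶠ[𝓝 0] (q * g + ∑ i ∈ Finset.range d, pull π (r i) * lc z ^ i).1 := by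
  obtain ⟨q, r, h1, h2⟩ := div_an j π z v0 hdec d g (lc z ^ d - g) hg0
  refine ⟨q + 1, r, ?_, ?_⟩
  · have : q.1 0 = 0 := h2 (by
      filter_upwards [hg0] with t ht
      show z (t • v0) ^ d - g.1 (t • v0) = 0
      rw [ht, map_smul, hz]; simp)
    show q.1 0 + 1 ≠ 0
    rw [this]; simp
  · filter_upwards [h1] with p hp
    have e1 : (lc z ^ d - g).1 p = (lc z ^ d).1 p - g.1 p := rfl
    have e2 : ((q + 1) * g + ∑ i ∈ Finset.range d, pull π (r i) * lc z ^ i).1 p =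
      (q * g + ∑ i ∈ Finset.range d, pull π (r i) * lc z ^ i).1 p + g.1 p := by
      show ((q + 1) * g + ∑ i ∈ Finset.range d, pull π (r i) * lc z ^ i).1 p =
        (q * g + ∑ i ∈ Finset.range d, pull π (r i) * lc z ^ i + g).1 p
      generalize ∑ i ∈ Finset.range d, pull π (r i) * lc z ^ i = S
      have : (q + 1) * g + S = q * g + S + g := by ring
      rw [this]
    rw [e2, ← hp, e1]
    ring

lemma core_alg [FiniteDimensional 𝕜 E] (hdec : ∀ p, p = j (π p) + z p • v0) (hz : z v0 = 1)
    (d : ℕ) (g : An 𝕜 E) (hg0 : ∀ᶠ t in 𝓝 (0 : 𝕜), g.1 (t • v0) = t ^ d)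
    (φ : An 𝕜 E →ₐ[𝕜] L) (hφ : GermHom φ) (hg : φ g = 0)
    (halg : Algebra.IsAlgebraic φ.range L) :
    Algebra.IsAlgebraic (φ.comp (pull π)).range L := by
  have hmem : ∀ f, IsIntegral (φ.comp (pull π)).range (φ (pull π f)) := fun f =>
    isIntegral_algebraMap (R := (φ.comp (pull π)).range) (A := L) (x := ⟨φ (pull π f), f, rfl⟩)
  have hzint : IsIntegral (φ.comp (pull π)).range (φ (lc z)) := by
    obtain ⟨q, r, -, h1⟩ := monic_an j π z v0 hdec hz d g hg0
    have h2 := hφ.congr h1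
    rw [map_add, map_mul, hg, mul_zero, zero_add, map_sum] at h2
    let c : ℕ → (φ.comp (pull π)).range := fun i => ⟨φ (pull π (r i)), r i, rfl⟩
    refine ⟨Polynomial.X ^ d - ∑ i ∈ Finset.range d, Polynomial.C (c i) * Polynomial.X ^ i,
      Polynomial.monic_X_pow_sub ?_, ?_⟩
    · refine (Polynomial.degree_sum_le _ _).trans_lt ?_
      rw [Finset.sup_lt_iff (by exact WithBot.bot_lt_coe d)]
      intro i hi
      exact (Polynomial.degree_C_mul_X_pow_le i (c i)).trans_lt
        (by exact_mod_cast Finset.mem_range.1 hi)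
    · rw [← Polynomial.aeval_def]
      simp only [map_sub, map_pow, map_sum, map_mul, Polynomial.aeval_X, Polynomial.aeval_C]
      rw [← map_pow, h2, sub_eq_zero]
      refine Finset.sum_congr rfl fun i _ => ?_
      rw [map_mul, map_pow]
      rfl
  have hall : ∀ h, IsIntegral (φ.comp (pull π)).range (φ h) := by
    intro h
    obtain ⟨q, r, h1, -⟩ := div_an j π z v0 hdec d g h hg0
    rw [hφ.congr h1, map_add, map_mul, hg, mul_zero, zero_add, map_sum]
    refine IsIntegral.sum _ fun i _ => ?_
    rw [map_mul, map_pow]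
    exact (hmem (r i)).mul (hzint.pow i)
  have hle : (φ.comp (pull π)).range ≤ φ.range := by
    rintro _ ⟨f, rfl⟩
    exact ⟨pull π f, rfl⟩
  let _ : Algebra (φ.comp (pull π)).range φ.range := (Subalgebra.inclusion hle).toRingHom.toAlgebra
  have : IsScalarTower (φ.comp (pull π)).range φ.range L := IsScalarTower.of_algebraMap_eq fun _ => rfl
  have : Algebra.IsAlgebraic (φ.comp (pull π)).range φ.range := by
    refine ⟨?_⟩
    rintro ⟨_, f, rfl⟩
    refine (isAlgebraic_algebraMap_iff (A := L) (Subtype.val_injective)).1 ?_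
    exact (hall f).isAlgebraic
  exact Algebra.IsAlgebraic.trans (φ.comp (pull π)).range φ.range L

lemma core_good [FiniteDimensional 𝕜 E] (hdec : ∀ p, p = j (π p) + z p • v0) (hz : z v0 = 1)
    (hπ : π v0 = 0) (hπj : ∀ h, π (j h) = h)
    (d : ℕ) (g : An 𝕜 E) (hg0 : ∀ᶠ t in 𝓝 (0 : 𝕜), g.1 (t • v0) = t ^ d)
    (φ : An 𝕜 E →ₐ[𝕜] L) (hφ : GermHom φ) (hg : φ g = 0) (D : Derivation 𝕜 L L)
    (hD : Good (φ.comp (pull π)) D) : Good φ D := by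
  have hle : vf (φ.comp (pull π)) ≤ (vf φ).map (LinearMap.funLeft L L (pull π)) := by
    refine Submodule.span_le.2 ?_
    rintro _ ⟨h, rfl⟩
    refine ⟨_, dv_mem_vf φ (j h), ?_⟩
    funext f
    show φ (dv (j h) (pull π f)) = φ (pull π (dv h f))
    rw [hφ.congr (dv_pull π (j h) f), hπj]
  obtain ⟨X, hX, hXD⟩ := hle hD
  have hXD' : ∀ f, X (pull π f) = D (φ (pull π f)) := fun f => congrFun hXD f
  let X' : An 𝕜 E → L := X + (D (φ (lc z)) - X (lc z)) • (fun f => φ (dv v0 f))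
  have hX' : X' ∈ vf φ := (vf φ).add_mem hX ((vf φ).smul_mem _ (dv_mem_vf φ v0))
  have hX'z : X' (lc z) = D (φ (lc z)) := by
    show X (lc z) + (D (φ (lc z)) - X (lc z)) * φ (dv v0 (lc z)) = _
    rw [dv_lc, hz]
    simp
  have hX'p : ∀ f, X' (pull π f) = D (φ (pull π f)) := by
    intro f
    show X (pull π f) + (D (φ (lc z)) - X (lc z)) * φ (dv v0 (pull π f)) = _
    have h0 : dv (0 : H) f = 0 := Subtype.ext (funext fun p => by
      show fderiv 𝕜 f.1 p 0 = 0
      simp)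
    rw [hXD', hφ.congr (dv_pull π v0 f), hπ, h0]
    simp
  let Y : An 𝕜 E → L := (fun f => D (φ f)) - X'
  have hY : Y ∈ DerOver φ := (DerOver φ).sub_mem (der_mem hφ D) (vf_le hφ hX')
  have hYz : Y (lc z) = 0 := by show D _ - X' _ = 0; rw [hX'z, sub_self]
  have hYp : ∀ f, Y (pull π f) = 0 := fun f => by show D _ - X' _ = 0; rw [hX'p, sub_self]
  have hYs : ∀ r : ℕ → An 𝕜 H, Y (∑ i ∈ Finset.range d, pull π (r i) * lc z ^ i) = 0 := fun r =>
    DerOver.sum hY _ _ fun i _ => DerOver.mul0 hY (hYp _) (DerOver.pow0 hY hYz i)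
  have hYg : Y g = 0 := by
    obtain ⟨q, r, hq, h1⟩ := monic_an j π z v0 hdec hz d g hg0
    have h2 := hY.2.2 _ _ h1
    rw [DerOver.pow0 hY hYz, hY.1, hYs, hY.2.1, hg, zero_mul, add_zero, add_zero] at h2
    exact (mul_eq_zero.1 h2.symm).resolve_left (hφ.ne_zero hq)
  have hYall : ∀ h, Y h = 0 := by
    intro h
    obtain ⟨q, r, h1, -⟩ := div_an j π z v0 hdec d g h hg0
    rw [hY.2.2 _ _ h1, hY.1, hYs, hY.2.1, hg, hYg]
    simp
  have : (fun f => D (φ f)) = X' := by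
    funext f
    exact sub_eq_zero.1 (hYall f)
  unfold Good
  rw [this]
  exact hX'

end Core

lemma tprop_noninj [FiniteDimensional 𝕜 E]
    (IH : ∀ H : Submodule 𝕜 E, Module.finrank 𝕜 H < Module.finrank 𝕜 E → TProp 𝕜 H)
    (φ : An 𝕜 E →ₐ[𝕜] L) (hφ : GermHom φ)
    (halg : Algebra.IsAlgebraic φ.range L) (g : An 𝕜 E) (hg : φ g = 0) (hgne : ¬ g.1 =ᶠ[𝓝 0] 0)
    (a : L) (ha : ∀ D, Good φ D → D a = 0) : IsAlgebraic 𝕜 a := by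
  obtain ⟨v0, hv0⟩ := exists_regular hgne
  have hv0ne : v0 ≠ 0 := by
    rintro rfl
    have hg0 : g.1 0 = 0 := by
      by_contra h
      exact hφ.ne_zero h hg
    apply hv0
    simp [hg0]
  obtain ⟨z, hz⟩ := SeparatingDual.exists_eq_one (R := 𝕜) hv0ne
  let H : Submodule 𝕜 E := LinearMap.ker (z : E →ₗ[𝕜] 𝕜)
  let j : H →L[𝕜] E := H.subtypeL
  let π : E →L[𝕜] H := (ContinuousLinearMap.id 𝕜 E - z.smulRight v0).codRestrict H (by
    intro p
    show z (p - z p • v0) = 0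
    simp [hz])
  have hπv : ∀ p, ((π p : H) : E) = p - z p • v0 := fun p => rfl
  have hdec : ∀ p, p = j (π p) + z p • v0 := by
    intro p
    show p = ((π p : H) : E) + z p • v0
    rw [hπv]; abel
  have hπ : π v0 = 0 := Subtype.ext (by rw [hπv, hz]; simp)
  have hπj : ∀ h, π (j h) = h := fun h => Subtype.ext (by
    have : z (j h) = 0 := h.2
    rw [hπv, this, zero_smul, sub_zero]; rfl)
  have hrank : Module.finrank 𝕜 H < Module.finrank 𝕜 E := by
    refine Submodule.finrank_lt ?_
    intro h
    have : v0 ∈ H := by rw [h]; trivial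
    have h0 : z v0 = 0 := this
    rw [hz] at h0
    exact one_ne_zero h0
  have han : AnalyticAt 𝕜 (fun t : 𝕜 => g.1 (t • v0)) 0 :=
    AnalyticAt.comp_of_eq g.2 ((ContinuousLinearMap.toSpanSingleton 𝕜 v0).analyticAt 0) (by simp)
  obtain ⟨d, w, hw, hw0, hgw⟩ := han.exists_eventuallyEq_pow_smul_nonzero_iff.2 hv0
  let wi : An 𝕜 E := ⟨fun p => (w (z p))⁻¹,
    (AnalyticAt.comp_of_eq hw (z.analyticAt 0) (map_zero z)).inv (by simpa using hw0)⟩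
  have hg' : φ (g * wi) = 0 := by rw [map_mul, hg, zero_mul]
  have hg0' : ∀ᶠ t in 𝓝 (0 : 𝕜), (g * wi).1 (t • v0) = t ^ d := by
    filter_upwards [hgw, hw.continuousAt.eventually_ne hw0] with t h1 h2
    show g.1 (t • v0) * (w (z (t • v0)))⁻¹ = t ^ d
    rw [h1, map_smul, hz]
    simp [h2]
  exact IH H hrank L (φ.comp (pull π)) (hφ.pull π)
    (core_alg j π z v0 hdec hz d _ hg0' φ hφ hg' halg) a
    fun D hD => ha D (core_good j π z v0 hdec hz hπ hπj d _ hg0' φ hφ hg' D hD)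

lemma tprop_all (n : ℕ) : ∀ (E : Type u) [NormedAddCommGroup E] [NormedSpace 𝕜 E]
    [FiniteDimensional 𝕜 E], Module.finrank 𝕜 E = n → TProp 𝕜 E := by
  induction n using Nat.strong_induction_on with
  | _ n ih =>
    intro E _ _ _ hn L _ _ φ hφ halg a ha
    by_cases hinj : ∀ f, φ f = 0 → f.1 =ᶠ[𝓝 0] 0
    · exact tprop_inj φ hφ halg hinj a ha
    · push Not at hinj
      obtain ⟨g, hg, hgne⟩ := hinj
      exact tprop_noninj (fun H hH => ih _ (hn ▸ hH) H rfl) φ hφ halg g hg hgne a ha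

lemma exists_hom {A : Type u} [CommRing A] [Algebra 𝕜 A] (P : Ideal A) [hP : P.IsPrime] :
    ∃ (L : Type u) (_ : Field L) (_ : Algebra 𝕜 L) (φ : A →ₐ[𝕜] L),
      (∀ h, φ h = 0 ↔ h ∈ P) ∧ Algebra.IsAlgebraic φ.range L := by
  let φ : A →ₐ[𝕜] FractionRing (A ⧸ P) :=
    (IsScalarTower.toAlgHom 𝕜 (A ⧸ P) (FractionRing (A ⧸ P))).comp (Ideal.Quotient.mkₐ 𝕜 P)
  have hφ : ∀ h, φ h = algebraMap (A ⧸ P) (FractionRing (A ⧸ P)) (Ideal.Quotient.mk P h) :=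
    fun _ => rfl
  refine ⟨FractionRing (A ⧸ P), inferInstance, inferInstance, φ, fun h => ?_, ⟨fun x => ?_⟩⟩
  · rw [hφ, map_eq_zero_iff _ (IsFractionRing.injective (A ⧸ P) (FractionRing (A ⧸ P))),
      Ideal.Quotient.eq_zero_iff_mem]
  · obtain ⟨a, b, hb, rfl⟩ := IsFractionRing.div_surjective (A := A ⧸ P) x
    obtain ⟨a, rfl⟩ := Ideal.Quotient.mk_surjective a
    obtain ⟨b, rfl⟩ := Ideal.Quotient.mk_surjective b
    rw [← hφ, ← hφ, div_eq_mul_inv]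
    have ha : IsAlgebraic φ.range (φ a) :=
      isAlgebraic_algebraMap (R := φ.range) (A := FractionRing (A ⧸ P)) ⟨φ a, a, rfl⟩
    have hb : IsAlgebraic φ.range (φ b) :=
      isAlgebraic_algebraMap (R := φ.range) (A := FractionRing (A ⧸ P)) ⟨φ b, b, rfl⟩
    exact ha.mul hb.inv

theorem critical_value [FiniteDimensional 𝕜 E] (F : E → 𝕜) (hF : AnalyticAt 𝕜 F 0) (hF0 : F 0 = 0) :
    ∀ᶠ p in 𝓝 (0 : E), (∀ v, fderiv 𝕜 F p v = 0) → F p = 0 := by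
  let f : An 𝕜 E := ⟨F, hF⟩
  let J : Ideal (An 𝕜 E) := Ideal.span ((range fun v : E => dv v f) ∪ {h | h.1 =ᶠ[𝓝 0] 0})
  have hrad : f ∈ J.radical := by
    rw [Ideal.radical_eq_sInf, Submodule.mem_sInf]
    rintro P ⟨hJP, hP⟩
    by_contra hfP
    obtain ⟨L, _, _, φ, hker, halg⟩ := exists_hom (𝕜 := 𝕜) P
    have hφP : ∀ h, h ∈ P → φ h = 0 := fun h hh => (hker h).2 hh
    have hφ : GermHom φ := fun h hh => hφP h (hJP (Ideal.subset_span (Or.inr hh)))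
    have hφf : φ f ≠ 0 := fun h => hfP ((hker f).1 h)
    have hD : ∀ D, Good φ D → D (φ f) = 0 := by
      intro D hD
      have key : ∀ X ∈ vf φ, X f = 0 := by
        intro X hX
        induction hX using Submodule.span_induction with
        | mem X hX =>
          obtain ⟨v, rfl⟩ := hX
          exact hφP _ (hJP (Ideal.subset_span (Or.inl ⟨v, rfl⟩)))
        | zero => rfl
        | add X Y _ _ h1 h2 => simp [h1, h2]
        | smul c X _ h1 => simp [h1]
      exact key _ hD
    have hintg : IsIntegral 𝕜 (φ f) := (tprop_all _ E rfl L φ hφ halg _ hD).isIntegral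
    have hc := minpoly.coeff_zero_ne_zero hintg hφf
    have h0 : φ (Polynomial.aeval f (minpoly 𝕜 (φ f))) = 0 := by
      rw [← Polynomial.aeval_algHom_apply]
      exact minpoly.aeval 𝕜 (φ f)
    refine hφ.ne_zero ?_ h0
    let ev : An 𝕜 E →ₐ[𝕜] 𝕜 := (Pi.evalAlgHom 𝕜 (fun _ : E => 𝕜) 0).comp (An 𝕜 E).val
    have h1 : ev (Polynomial.aeval f (minpoly 𝕜 (φ f))) = (minpoly 𝕜 (φ f)).coeff 0 := by
      rw [← Polynomial.aeval_algHom_apply]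
      have : ev f = 0 := hF0
      rw [this, Polynomial.coeff_zero_eq_aeval_zero]
    exact fun h2 => hc (h1.symm.trans h2)
  obtain ⟨k, hk⟩ := hrad
  have hJ : ∀ h ∈ J, ∀ᶠ p in 𝓝 (0 : E), (∀ v, fderiv 𝕜 F p v = 0) → h.1 p = 0 := by
    intro h hh
    induction hh using Submodule.span_induction with
    | mem h hh =>
      rcases hh with ⟨v, rfl⟩ | hh
      · exact Eventually.of_forall fun p hp => hp v
      · exact Eventually.mono hh fun p hp _ => hp
    | zero => exact Eventually.of_forall fun p _ => rfl
    | add a b _ _ h1 h2 =>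
      filter_upwards [h1, h2] with p h1 h2 hp
      show a.1 p + b.1 p = 0
      rw [h1 hp, h2 hp, add_zero]
    | smul c a _ h1 =>
      filter_upwards [h1] with p h1 hp
      show c.1 p * a.1 p = 0
      rw [h1 hp, mul_zero]
  filter_upwards [hJ _ hk] with p hp h
  have : F p ^ k = 0 := hp h
  exact eq_zero_of_pow_eq_zero this
end Germ

/-- Let `F : (𝕂ⁿ × 𝕂, 0) → (𝕂, 0)` be an analytic deformation satisfying
condition (*): for every `x₀` (near `0`) in `Sing F₀ ∩ {∂F/∂t(·,0) = 0}` there is `c > 0`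
with `|∂F/∂t| ≤ c·‖∂F/∂x‖` near `(x₀, 0)`.  Then, as germs at the origin,
`Sing F = Sing F̃` (where `F̃ = (F, t)`), and consequently the discriminant
`F̃(Sing F̃)` is contained in `{0} × 𝕂`, i.e. `F` vanishes on `Sing F̃` near `0`. -/
theorem stmt_8 {𝕜 : Type*} [RCLike 𝕜] (n : ℕ)
    (F : (Fin n → 𝕜) × 𝕜 → 𝕜) (hF : AnalyticAt 𝕜 F 0)
    (hF00 : F 0 = 0) (hF0t : ∀ᶠ t in 𝓝 (0 : 𝕜), F (0, t) = 0)
    -- partial derivatives: `Dx i p = ∂F/∂xᵢ(p)`, `Dt p = ∂F/∂t(p)`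
    (Dx : Fin n → ((Fin n → 𝕜) × 𝕜 → 𝕜)) (Dt : (Fin n → 𝕜) × 𝕜 → 𝕜)
    (hDx : ∀ i p, Dx i p = fderiv 𝕜 F p (Pi.single i 1, 0))
    (hDt : ∀ p, Dt p = fderiv 𝕜 F p (0, 1))
    -- condition (*)
    (hstar : ∀ᶠ x₀ in 𝓝 (0 : Fin n → 𝕜),
      (∀ i, Dx i (x₀, 0) = 0) → Dt (x₀, 0) = 0 →
        ∃ c > (0 : ℝ), ∀ᶠ p in 𝓝 ((x₀, 0) : (Fin n → 𝕜) × 𝕜),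
          ‖Dt p‖ ≤ c * ‖(fun i => Dx i p : Fin n → 𝕜)‖) :
    (∀ᶠ p in 𝓝 (0 : (Fin n → 𝕜) × 𝕜),
        ((∀ i, Dx i p = 0) ∧ Dt p = 0 ↔ (∀ i, Dx i p = 0))) ∧
    (∀ᶠ p in 𝓝 (0 : (Fin n → 𝕜) × 𝕜), (∀ i, Dx i p = 0) → F p = 0) := by
  have hkey : ∀ᶠ p in 𝓝 (0 : (Fin n → 𝕜) × 𝕜), (∀ i, Dx i p = 0) → Dt p = 0 := by
    by_cases h0 : ∀ i, Dx i 0 = 0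
    · have hDt0 : Dt 0 = 0 := by
        rw [hDt]
        have h1 : HasDerivAt (fun t : 𝕜 => F ((0, t) : (Fin n → 𝕜) × 𝕜))
            (fderiv 𝕜 F 0 (0, 1)) 0 := by
          have hd : HasFDerivAt F (fderiv 𝕜 F 0) ((0, 0) : (Fin n → 𝕜) × 𝕜) :=
            hF.differentiableAt.hasFDerivAt
          exact hd.comp_hasDerivAt (0 : 𝕜)
            ((hasDerivAt_const (0 : 𝕜) (0 : Fin n → 𝕜)).prodMk (hasDerivAt_id (0 : 𝕜)))
        have h2 : HasDerivAt (fun t : 𝕜 => F ((0, t) : (Fin n → 𝕜) × 𝕜)) 0 0 :=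
          (hasDerivAt_const (0 : 𝕜) (0 : 𝕜)).congr_of_eventuallyEq hF0t
        exact h1.unique h2
      obtain ⟨c, -, hc⟩ := hstar.self_of_nhds h0 hDt0
      filter_upwards [hc] with p hp hx
      have h3 : (fun i => Dx i p : Fin n → 𝕜) = 0 := funext hx
      rw [h3, norm_zero, mul_zero] at hp
      exact norm_le_zero_iff.1 hp
    · push Not at h0
      obtain ⟨i, hi⟩ := h0
      have hcont : ContinuousAt (Dx i) 0 := by
        have : Dx i = fun p => fderiv 𝕜 F p (Pi.single i 1, 0) := funext (hDx i)
        rw [this]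
        exact hF.fderiv.continuousAt.clm_apply continuousAt_const
      filter_upwards [hcont.eventually_ne hi] with p hp hx
      exact absurd (hx i) hp
  refine ⟨?_, ?_⟩
  · filter_upwards [hkey] with p hp
    exact ⟨fun h => h.1, fun h => ⟨h, hp h⟩⟩
  · filter_upwards [hkey, critical_value F hF hF00] with p h1 h2 hx
    apply h2
    have ht := h1 hx
    rintro ⟨x, t⟩
    have hdecomp : ((x, t) : (Fin n → 𝕜) × 𝕜) =
        ∑ i, x i • ((Pi.single i 1, 0) : (Fin n → 𝕜) × 𝕜) + t • ((0, 1) : (Fin n → 𝕜) × 𝕜) := by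
      refine Prod.ext ?_ ?_
      · funext k
        simp [Prod.fst_sum, Finset.sum_apply, Pi.single_apply]
      · simp [Prod.snd_sum]
    rw [hdecomp, map_add, map_sum, map_smul, ← hDt, ht, smul_zero, add_zero]
    refine Finset.sum_eq_zero fun i _ => ?_
    rw [map_smul, ← hDx, hx i, smul_zero]
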